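/- Assume ω ∈ ℝ^r is nonresonant (α·ω = 0 implies α = 0 for α ∈ ℤ^r). Let κ ≥ 0, M > 0, c ∈ (0,1). Let a : [0,∞) → End(X) be sharp-flat of class κ with 𝒩_κ(a) ≤ M, and let φ : [0,∞) → End(X) be sharp-flat of class κ with 𝒩_κ(φ − id) ≤ c, where id denotes the constant map equal to the identity operator. Then the time average ⟨aφ⟩ exists, the map Λ{φ}_τ := a_τ φ_τ − φ_τ ⟨aφ⟩ is sharp-flat of class κ, and 𝒩_κ(Λ{φ}) ≤ (2+c)(1+c) M. -/

import Mathlib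

open scoped BigOperators
open Filter MeasureTheory

noncomputable section

variable {X : Type*} [NormedAddCommGroup X] [NormedSpace ℂ X] [CompleteSpace X]

/-- `|α| = |α₁| + ⋯ + |α_r|` for a multi-index `α ∈ ℤ^r`. -/
def absIdx {r : ℕ} (α : Fin r → ℤ) : ℝ := ∑ i, |(α i : ℝ)|

/-- `α · ω = α₁ω₁ + ⋯ + α_rω_r`. -/
def dotIdx {r : ℕ} (ω : Fin r → ℝ) (α : Fin r → ℤ) : ℝ := ∑ i, (α i : ℝ) * ω i

/-- The quasi-periodic ("sharp") map generated by a family of Fourier coefficients: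
`τ ↦ Σ_α e^{i(α·ω)τ} φ̂_α`. -/
def sharpSum {r : ℕ} (ω : Fin r → ℝ) (φhat : (Fin r → ℤ) → (X →L[ℂ] X)) (τ : ℝ) :
    X →L[ℂ] X :=
  ∑' α : Fin r → ℤ, Complex.exp (Complex.I * (dotIdx ω α : ℂ) * (τ : ℂ)) • φhat α

/-- The weighted ℓ¹-norm `Σ_α e^{κ|α|} ‖φ̂_α‖` of a family of Fourier coefficients. -/
def sharpNorm {r : ℕ} (κ : ℝ) (φhat : (Fin r → ℤ) → (X →L[ℂ] X)) : ℝ :=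
  ∑' α : Fin r → ℤ, Real.exp (κ * absIdx α) * ‖φhat α‖

/-- `sup_{τ ≥ 0} e^τ ‖φ♭_τ‖` for the exponentially decaying ("flat") part. -/
def flatSup (φflat : ℝ → (X →L[ℂ] X)) : ℝ :=
  ⨆ τ : Set.Ici (0:ℝ), Real.exp (τ : ℝ) * ‖φflat (τ : ℝ)‖

/-- The sharp-flat norm `𝒩_κ(φ) = Σ_α e^{κ|α|}‖φ̂_α‖ + sup_{τ≥0} e^τ‖φ♭_τ‖`. -/
def SFNorm {r : ℕ} (κ : ℝ) (φhat : (Fin r → ℤ) → (X →L[ℂ] X))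
    (φflat : ℝ → (X →L[ℂ] X)) : ℝ :=
  sharpNorm κ φhat + flatSup φflat

/-- `φ : [0,∞) → End(X)` is sharp-flat of class `κ`, with sharp Fourier coefficients
`φhat` and flat part `φflat`. -/
structure IsSharpFlat {r : ℕ} (ω : Fin r → ℝ) (κ : ℝ) (φ : ℝ → (X →L[ℂ] X))
    (φhat : (Fin r → ℤ) → (X →L[ℂ] X)) (φflat : ℝ → (X →L[ℂ] X)) : Prop where
  summable : Summable fun α : Fin r → ℤ => Real.exp (κ * absIdx α) * ‖φhat α‖
  flat_cont : ContinuousOn φflat (Set.Ici 0)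
  flat_bdd : BddAbove (Set.range fun τ : Set.Ici (0:ℝ) => Real.exp (τ : ℝ) * ‖φflat (τ : ℝ)‖)
  decomp : ∀ τ : ℝ, 0 ≤ τ → φ τ = sharpSum ω φhat τ + φflat τ

/-- The time average `⟨φ⟩ = lim_{T→∞} (1/T) ∫₀^T φ_σ dσ` equals `B`. -/
def HasTimeAvg {E : Type*} [NormedAddCommGroup E] [NormedSpace ℝ E] (φ : ℝ → E) (B : E) : Prop :=
  Tendsto (fun T : ℝ => (1 / T) • ∫ σ in (0:ℝ)..T, φ σ) atTop (nhds B)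

/-- The constant `c_I(κ) = max{1, (1/c_D)(ν/(κe))^ν}` from the integration lemma. -/
def cI (c_D ν κ : ℝ) : ℝ := max 1 ((1 / c_D) * (ν / (κ * Real.exp 1)) ^ ν)

lemma absIdx_nonneg' {r : ℕ} (α : Fin r → ℤ) : 0 ≤ absIdx α :=
  Finset.sum_nonneg fun _ _ => abs_nonneg _

lemma absIdx_add_le {r : ℕ} (α β : Fin r → ℤ) : absIdx (α + β) ≤ absIdx α + absIdx β := by
  unfold absIdx
  rw [← Finset.sum_add_distrib]
  refine Finset.sum_le_sum fun i _ => ?_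
  simp only [Pi.add_apply, Int.cast_add]
  exact abs_add_le _ _

lemma dotIdx_add' {r : ℕ} (ω : Fin r → ℝ) (α β : Fin r → ℤ) :
    dotIdx ω (α + β) = dotIdx ω α + dotIdx ω β := by
  unfold dotIdx
  rw [← Finset.sum_add_distrib]
  refine Finset.sum_congr rfl fun i _ => ?_
  simp only [Pi.add_apply, Int.cast_add]
  ring

lemma one_le_wt {r : ℕ} {κ : ℝ} (hκ : 0 ≤ κ) (α : Fin r → ℤ) : 1 ≤ Real.exp (κ * absIdx α) :=
  Real.one_le_exp (mul_nonneg hκ (absIdx_nonneg' α))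

lemma wt_add_le {r : ℕ} {κ : ℝ} (hκ : 0 ≤ κ) (α β : Fin r → ℤ) :
    Real.exp (κ * absIdx (α + β)) ≤ Real.exp (κ * absIdx α) * Real.exp (κ * absIdx β) := by
  rw [← Real.exp_add, ← mul_add]
  exact Real.exp_le_exp.2 (mul_le_mul_of_nonneg_left (absIdx_add_le α β) hκ)

lemma norm_phase (l τ : ℝ) : ‖Complex.exp (Complex.I * (l : ℂ) * (τ : ℂ))‖ = 1 := by
  rw [Complex.norm_exp]
  simp

lemma norm_le_wt {r : ℕ} {κ : ℝ} (hκ : 0 ≤ κ) (f : (Fin r → ℤ) → (X →L[ℂ] X)) (α : Fin r → ℤ) :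
    ‖f α‖ ≤ Real.exp (κ * absIdx α) * ‖f α‖ :=
  le_mul_of_one_le_left (norm_nonneg _) (one_le_wt hκ α)

lemma summable_norm_of_wt {r : ℕ} {κ : ℝ} (hκ : 0 ≤ κ) {f : (Fin r → ℤ) → (X →L[ℂ] X)}
    (hf : Summable fun α : Fin r → ℤ => Real.exp (κ * absIdx α) * ‖f α‖) :
    Summable fun α => ‖f α‖ :=
  Summable.of_nonneg_of_le (fun _ => norm_nonneg _) (norm_le_wt hκ f) hf

lemma summable_norm_term {r : ℕ} (ω : Fin r → ℝ) {f : (Fin r → ℤ) → (X →L[ℂ] X)}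
    (hf : Summable fun α => ‖f α‖) (τ : ℝ) :
    Summable fun α => ‖Complex.exp (Complex.I * (dotIdx ω α : ℂ) * (τ : ℂ)) • f α‖ := by
  simpa [norm_smul, norm_phase] using hf

lemma norm_sharpSum_le {r : ℕ} (ω : Fin r → ℝ) {κ : ℝ} (hκ : 0 ≤ κ)
    {f : (Fin r → ℤ) → (X →L[ℂ] X)}
    (hf : Summable fun α : Fin r → ℤ => Real.exp (κ * absIdx α) * ‖f α‖) (τ : ℝ) :
    ‖sharpSum ω f τ‖ ≤ sharpNorm κ f := by
  refine tsum_of_norm_bounded hf.hasSum fun α => ?_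
  rw [norm_smul, norm_phase, one_mul]
  exact norm_le_wt hκ f α

lemma continuous_sharpSum {r : ℕ} (ω : Fin r → ℝ) {f : (Fin r → ℤ) → (X →L[ℂ] X)}
    (hf : Summable fun α => ‖f α‖) : Continuous (sharpSum ω f) := by
  refine continuous_tsum (u := fun α => ‖f α‖) (fun α => ?_) hf fun α τ => ?_
  · fun_prop
  · rw [norm_smul, norm_phase, one_mul]

lemma sharpNorm_nonneg' {r : ℕ} (κ : ℝ) (f : (Fin r → ℤ) → (X →L[ℂ] X)) : 0 ≤ sharpNorm κ f :=
  tsum_nonneg fun _ => by positivity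

lemma flatSup_nonneg' (f : ℝ → (X →L[ℂ] X)) : 0 ≤ flatSup f :=
  Real.iSup_nonneg fun _ => by positivity

/-- convolution of coefficient families -/
def convHat {r : ℕ} (f g : (Fin r → ℤ) → (X →L[ℂ] X)) (γ : Fin r → ℤ) : X →L[ℂ] X :=
  ∑' α : Fin r → ℤ, f α * g (γ - α)

/-- the reindexing `(γ, α) ↦ (α, γ - α)` -/
def shearEquiv (r : ℕ) : (Fin r → ℤ) × (Fin r → ℤ) ≃ (Fin r → ℤ) × (Fin r → ℤ) where
  toFun p := (p.2, p.1 - p.2)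
  invFun q := (q.1 + q.2, q.1)
  left_inv p := by simp
  right_inv q := by simp

lemma conv_bound {r : ℕ} {κ : ℝ} (hκ : 0 ≤ κ) {f g : (Fin r → ℤ) → (X →L[ℂ] X)}
    (hf : Summable fun α : Fin r → ℤ => Real.exp (κ * absIdx α) * ‖f α‖)
    (hg : Summable fun α : Fin r → ℤ => Real.exp (κ * absIdx α) * ‖g α‖) :
    (Summable fun α : Fin r → ℤ => Real.exp (κ * absIdx α) * ‖convHat f g α‖) ∧
      sharpNorm κ (convHat f g) ≤ sharpNorm κ f * sharpNorm κ g := by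
  have h1 := hf.mul_of_nonneg hg (fun _ => by positivity) (fun _ => by positivity)
  have h2 := (shearEquiv r).summable_iff.2 h1
  have key : ∀ γ, Real.exp (κ * absIdx γ) * ‖convHat f g γ‖ ≤
      ∑' α : Fin r → ℤ, (Real.exp (κ * absIdx α) * ‖f α‖) *
        (Real.exp (κ * absIdx (γ - α)) * ‖g (γ - α)‖) := by
    intro γ
    have hs := h2.prod_factor γ
    have e : Real.exp (κ * absIdx γ) * ‖convHat f g γ‖ =
        ‖∑' α : Fin r → ℤ, (Real.exp (κ * absIdx γ) : ℂ) • (f α * g (γ - α))‖ := by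
      rw [tsum_const_smul'', norm_smul]
      congr 1
      rw [Complex.norm_real, Real.norm_of_nonneg (Real.exp_pos _).le]
    rw [e]
    refine tsum_of_norm_bounded hs.hasSum fun α => ?_
    simp only [shearEquiv, Function.comp, Equiv.coe_fn_mk]
    rw [norm_smul, Complex.norm_real,
      Real.norm_of_nonneg (Real.exp_pos _).le]
    have hw := wt_add_le hκ α (γ - α)
    rw [add_sub_cancel] at hw
    calc Real.exp (κ * absIdx γ) * ‖f α * g (γ - α)‖
        ≤ (Real.exp (κ * absIdx α) * Real.exp (κ * absIdx (γ - α))) * (‖f α‖ * ‖g (γ - α)‖) :=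
          mul_le_mul hw (norm_mul_le _ _) (norm_nonneg _) (by positivity)
      _ = _ := by ring
  have hsum := Summable.of_nonneg_of_le (fun _ => by positivity) key h2.prod
  refine ⟨hsum, ?_⟩
  unfold sharpNorm
  rw [hf.tsum_mul_tsum hg h1, ← (shearEquiv r).tsum_eq]
  erw [h2.tsum_prod]
  exact hsum.tsum_le_tsum key h2.prod

lemma sharpSum_conv {r : ℕ} (ω : Fin r → ℝ) {f g : (Fin r → ℤ) → (X →L[ℂ] X)}
    (hf : Summable fun α => ‖f α‖) (hg : Summable fun α => ‖g α‖) (τ : ℝ) :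
    sharpSum ω (convHat f g) τ = sharpSum ω f τ * sharpSum ω g τ := by
  have hf' := summable_norm_term ω hf τ
  have hg' := summable_norm_term ω hg τ
  have h1 := summable_mul_of_summable_norm hf' hg'
  have h2 := (shearEquiv r).summable_iff.2 h1
  unfold sharpSum
  rw [tsum_mul_tsum_of_summable_norm hf' hg', ← (shearEquiv r).tsum_eq]
  erw [h2.tsum_prod]
  refine tsum_congr fun γ => ?_
  unfold convHat
  rw [← tsum_const_smul'']
  refine tsum_congr fun α => ?_
  simp only [shearEquiv, Function.comp, Equiv.coe_fn_mk]
  rw [smul_mul_smul_comm, ← Complex.exp_add]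
  congr 2
  have := dotIdx_add' ω α (γ - α)
  rw [add_sub_cancel] at this
  rw [this]
  push_cast
  ring

lemma flat_le {f : ℝ → (X →L[ℂ] X)}
    (h : BddAbove (Set.range fun τ : Set.Ici (0:ℝ) => Real.exp (τ : ℝ) * ‖f (τ : ℝ)‖))
    {τ : ℝ} (hτ : 0 ≤ τ) : Real.exp τ * ‖f τ‖ ≤ flatSup f :=
  le_ciSup h (⟨τ, hτ⟩ : Set.Ici (0:ℝ))

lemma flat_of_le {f : ℝ → (X →L[ℂ] X)} {C : ℝ}
    (h : ∀ τ, 0 ≤ τ → Real.exp τ * ‖f τ‖ ≤ C) :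
    BddAbove (Set.range fun τ : Set.Ici (0:ℝ) => Real.exp (τ : ℝ) * ‖f (τ : ℝ)‖) ∧
      flatSup f ≤ C := by
  refine ⟨⟨C, ?_⟩, ?_⟩
  · rintro _ ⟨τ, rfl⟩
    exact h τ τ.2
  · have : Nonempty (Set.Ici (0:ℝ)) := ⟨⟨0, le_refl (0:ℝ)⟩⟩
    exact ciSup_le fun τ => h τ τ.2

lemma norm_flat_le {f : ℝ → (X →L[ℂ] X)}
    (h : BddAbove (Set.range fun τ : Set.Ici (0:ℝ) => Real.exp (τ : ℝ) * ‖f (τ : ℝ)‖))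
    {τ : ℝ} (hτ : 0 ≤ τ) : ‖f τ‖ ≤ flatSup f :=
  (le_mul_of_one_le_left (norm_nonneg _) (Real.one_le_exp hτ)).trans (flat_le h hτ)

/-- products of sharp-flat maps -/
lemma IsSharpFlat.mul' {r : ℕ} {ω : Fin r → ℝ} {κ : ℝ} (hκ : 0 ≤ κ)
    {a b : ℝ → (X →L[ℂ] X)} {ah bh : (Fin r → ℤ) → (X →L[ℂ] X)} {af bf : ℝ → (X →L[ℂ] X)}
    (ha : IsSharpFlat ω κ a ah af) (hb : IsSharpFlat ω κ b bh bf) :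
    IsSharpFlat ω κ (fun τ => a τ * b τ) (convHat ah bh)
      (fun τ => sharpSum ω ah τ * bf τ + af τ * sharpSum ω bh τ + af τ * bf τ) ∧
    SFNorm κ (convHat ah bh)
      (fun τ => sharpSum ω ah τ * bf τ + af τ * sharpSum ω bh τ + af τ * bf τ) ≤
      SFNorm κ ah af * SFNorm κ bh bf := by
  have hca := summable_norm_of_wt hκ ha.summable
  have hcb := summable_norm_of_wt hκ hb.summable
  obtain ⟨hs, hn⟩ := conv_bound hκ ha.summable hb.summable
  have hfl : ∀ τ, 0 ≤ τ → Real.exp τ *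
      ‖sharpSum ω ah τ * bf τ + af τ * sharpSum ω bh τ + af τ * bf τ‖ ≤
      sharpNorm κ ah * flatSup bf + flatSup af * sharpNorm κ bh + flatSup af * flatSup bf := by
    intro τ hτ
    have e := Real.exp_pos τ
    have n1 := norm_sharpSum_le ω hκ ha.summable τ
    have n2 := norm_sharpSum_le ω hκ hb.summable τ
    have n3 := flat_le ha.flat_bdd hτ
    have n4 := flat_le hb.flat_bdd hτ
    have n5 := norm_flat_le hb.flat_bdd hτ
    have p1 : Real.exp τ * ‖sharpSum ω ah τ * bf τ‖ ≤ sharpNorm κ ah * flatSup bf := by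
      calc _ ≤ Real.exp τ * (‖sharpSum ω ah τ‖ * ‖bf τ‖) := by gcongr; exact norm_mul_le _ _
        _ = ‖sharpSum ω ah τ‖ * (Real.exp τ * ‖bf τ‖) := by ring
        _ ≤ _ := mul_le_mul n1 n4 (by positivity) (sharpNorm_nonneg' _ _)
    have p2 : Real.exp τ * ‖af τ * sharpSum ω bh τ‖ ≤ flatSup af * sharpNorm κ bh := by
      calc _ ≤ Real.exp τ * (‖af τ‖ * ‖sharpSum ω bh τ‖) := by gcongr; exact norm_mul_le _ _
        _ = (Real.exp τ * ‖af τ‖) * ‖sharpSum ω bh τ‖ := by ring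
        _ ≤ _ := mul_le_mul n3 n2 (by positivity) (flatSup_nonneg' _)
    have p3 : Real.exp τ * ‖af τ * bf τ‖ ≤ flatSup af * flatSup bf := by
      calc _ ≤ Real.exp τ * (‖af τ‖ * ‖bf τ‖) := by gcongr; exact norm_mul_le _ _
        _ = (Real.exp τ * ‖af τ‖) * ‖bf τ‖ := by ring
        _ ≤ _ := mul_le_mul n3 n5 (by positivity) (flatSup_nonneg' _)
    calc _ ≤ Real.exp τ * (‖sharpSum ω ah τ * bf τ‖ + ‖af τ * sharpSum ω bh τ‖
          + ‖af τ * bf τ‖) := by gcongr; exact norm_add₃_le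
      _ ≤ _ := by rw [mul_add, mul_add]; gcongr
  obtain ⟨hbd, hle⟩ := flat_of_le hfl
  refine ⟨⟨hs, ?_, hbd, ?_⟩, ?_⟩
  · have c1 := (continuous_sharpSum ω hca).continuousOn (s := Set.Ici 0)
    have c2 := (continuous_sharpSum ω hcb).continuousOn (s := Set.Ici 0)
    exact ((c1.mul hb.flat_cont).add (ha.flat_cont.mul c2)).add (ha.flat_cont.mul hb.flat_cont)
  · intro τ hτ
    rw [ha.decomp τ hτ, hb.decomp τ hτ, sharpSum_conv ω hca hcb]
    noncomm_ring
  · unfold SFNorm at *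
    calc _ ≤ sharpNorm κ ah * sharpNorm κ bh + (sharpNorm κ ah * flatSup bf
          + flatSup af * sharpNorm κ bh + flatSup af * flatSup bf) := add_le_add hn hle
      _ = _ := by ring

/-- right multiplication by a constant -/
lemma IsSharpFlat.mul_const' {r : ℕ} {ω : Fin r → ℝ} {κ : ℝ} (hκ : 0 ≤ κ)
    {a : ℝ → (X →L[ℂ] X)} {ah : (Fin r → ℤ) → (X →L[ℂ] X)} {af : ℝ → (X →L[ℂ] X)}
    (ha : IsSharpFlat ω κ a ah af) (B : X →L[ℂ] X) :
    IsSharpFlat ω κ (fun τ => a τ * B) (fun α => ah α * B) (fun τ => af τ * B) ∧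
    SFNorm κ (fun α => ah α * B) (fun τ => af τ * B) ≤ SFNorm κ ah af * ‖B‖ := by
  have key : ∀ α, Real.exp (κ * absIdx α) * ‖ah α * B‖ ≤
      (Real.exp (κ * absIdx α) * ‖ah α‖) * ‖B‖ := fun α => by
    rw [mul_assoc]; gcongr; exact norm_mul_le _ _
  have hs : Summable fun α => Real.exp (κ * absIdx α) * ‖ah α * B‖ :=
    Summable.of_nonneg_of_le (fun _ => by positivity) key (ha.summable.mul_right _)
  obtain ⟨hbd, hle⟩ := flat_of_le (f := fun τ => af τ * B) (C := flatSup af * ‖B‖) fun τ hτ => by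
    calc _ ≤ Real.exp τ * (‖af τ‖ * ‖B‖) := by gcongr; exact norm_mul_le _ _
      _ = (Real.exp τ * ‖af τ‖) * ‖B‖ := by ring
      _ ≤ _ := by gcongr; exact flat_le ha.flat_bdd hτ
  refine ⟨⟨hs, ha.flat_cont.mul continuousOn_const, hbd, ?_⟩, ?_⟩
  · intro τ hτ
    rw [ha.decomp τ hτ, add_mul]
    congr 1
    unfold sharpSum
    rw [← (summable_norm_term ω (summable_norm_of_wt hκ ha.summable) τ).of_norm.tsum_mul_right]
    exact tsum_congr fun α => smul_mul_assoc _ _ _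
  · unfold SFNorm
    rw [add_mul]
    refine add_le_add ?_ hle
    unfold sharpNorm
    rw [← tsum_mul_right]
    exact hs.tsum_le_tsum key (ha.summable.mul_right _)

/-- differences of sharp-flat maps -/
lemma IsSharpFlat.sub' {r : ℕ} {ω : Fin r → ℝ} {κ : ℝ} (hκ : 0 ≤ κ)
    {a b : ℝ → (X →L[ℂ] X)} {ah bh : (Fin r → ℤ) → (X →L[ℂ] X)} {af bf : ℝ → (X →L[ℂ] X)}
    (ha : IsSharpFlat ω κ a ah af) (hb : IsSharpFlat ω κ b bh bf) :
    IsSharpFlat ω κ (fun τ => a τ - b τ) (fun α => ah α - bh α) (fun τ => af τ - bf τ) ∧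
    SFNorm κ (fun α => ah α - bh α) (fun τ => af τ - bf τ) ≤ SFNorm κ ah af + SFNorm κ bh bf := by
  have key : ∀ α, Real.exp (κ * absIdx α) * ‖ah α - bh α‖ ≤
      Real.exp (κ * absIdx α) * ‖ah α‖ + Real.exp (κ * absIdx α) * ‖bh α‖ := fun α => by
    rw [← mul_add]; gcongr; exact norm_sub_le _ _
  have hs : Summable fun α => Real.exp (κ * absIdx α) * ‖ah α - bh α‖ :=
    Summable.of_nonneg_of_le (fun _ => by positivity) key (ha.summable.add hb.summable)
  obtain ⟨hbd, hle⟩ := flat_of_le (f := fun τ => af τ - bf τ) (C := flatSup af + flatSup bf)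
    fun τ hτ => by
      calc _ ≤ Real.exp τ * (‖af τ‖ + ‖bf τ‖) := by gcongr; exact norm_sub_le _ _
        _ ≤ _ := by
          rw [mul_add]; exact add_le_add (flat_le ha.flat_bdd hτ) (flat_le hb.flat_bdd hτ)
  refine ⟨⟨hs, ha.flat_cont.sub hb.flat_cont, hbd, ?_⟩, ?_⟩
  · intro τ hτ
    rw [ha.decomp τ hτ, hb.decomp τ hτ, add_sub_add_comm]
    congr 1
    unfold sharpSum
    rw [← (summable_norm_term ω (summable_norm_of_wt hκ ha.summable) τ).of_norm.tsum_sub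
      (summable_norm_term ω (summable_norm_of_wt hκ hb.summable) τ).of_norm]
    exact tsum_congr fun α => (smul_sub _ _ _).symm
  · unfold SFNorm
    have : sharpNorm κ (fun α => ah α - bh α) ≤ sharpNorm κ ah + sharpNorm κ bh := by
      unfold sharpNorm
      rw [← ha.summable.tsum_add hb.summable]
      exact hs.tsum_le_tsum key (ha.summable.add hb.summable)
    linarith

lemma phase_avg {r : ℕ} (ω : Fin r → ℝ) (hres : ∀ α : Fin r → ℤ, dotIdx ω α = 0 → α = 0)
    (α : Fin r → ℤ) :
    Tendsto (fun T : ℝ => ((1 / T : ℝ) : ℂ) *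
      ∫ σ in (0:ℝ)..T, Complex.exp (Complex.I * (dotIdx ω α : ℂ) * (σ : ℂ))) atTop
      (nhds (if α = 0 then 1 else 0)) := by
  split_ifs with h
  · subst h
    have h0 : dotIdx ω (0 : Fin r → ℤ) = 0 := by simp [dotIdx]
    refine tendsto_const_nhds.congr' ?_
    filter_upwards [eventually_gt_atTop 0] with T hT
    have : (T : ℂ) ≠ 0 := by exact_mod_cast hT.ne'
    simp [h0, this]
  · have hl : dotIdx ω α ≠ 0 := fun h' => h (hres α h')
    have hl' : Complex.I * (dotIdx ω α : ℂ) ≠ 0 :=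
      mul_ne_zero Complex.I_ne_zero (by exact_mod_cast hl)
    have hz : Tendsto (fun T : ℝ => (1 / T) * (2 / |dotIdx ω α|)) atTop (nhds 0) := by
      simpa using (tendsto_inv_atTop_zero (𝕜 := ℝ)).mul_const (2 / |dotIdx ω α|)
    refine squeeze_zero_norm' ?_ hz
    filter_upwards [eventually_gt_atTop 0] with T hT
    have hn : ‖Complex.I * (dotIdx ω α : ℂ)‖ = |dotIdx ω α| := by simp
    have h2 : ‖Complex.exp (Complex.I * (dotIdx ω α : ℂ) * (T : ℂ)) -
        Complex.exp (Complex.I * (dotIdx ω α : ℂ) * ((0:ℝ) : ℂ))‖ ≤ 2 := by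
      refine (norm_sub_le _ _).trans ?_
      rw [norm_phase, norm_phase]
      norm_num
    rw [integral_exp_mul_complex hl', norm_mul, Complex.norm_real,
      Real.norm_of_nonneg (by positivity), norm_div, hn]
    exact mul_le_mul_of_nonneg_left (div_le_div_of_nonneg_right h2 (abs_nonneg _))
      (by positivity)

lemma phase_avg_norm {l T : ℝ} (hT : 0 < T) :
    ‖((1 / T : ℝ) : ℂ) * ∫ σ in (0:ℝ)..T, Complex.exp (Complex.I * (l : ℂ) * (σ : ℂ))‖ ≤ 1 := by
  have := intervalIntegral.norm_integral_le_of_norm_le_const (a := 0) (b := T) (C := 1)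
    (f := fun σ : ℝ => Complex.exp (Complex.I * (l : ℂ) * (σ : ℂ))) fun σ _ => (norm_phase l σ).le
  rw [norm_mul, Complex.norm_real, Real.norm_of_nonneg (by positivity)]
  rw [sub_zero, abs_of_pos hT, one_mul] at this
  calc _ ≤ 1 / T * T := by gcongr
    _ = 1 := by field_simp

lemma sharp_avg {r : ℕ} (ω : Fin r → ℝ) (hres : ∀ α : Fin r → ℤ, dotIdx ω α = 0 → α = 0)
    {f : (Fin r → ℤ) → (X →L[ℂ] X)} (hf : Summable fun α => ‖f α‖) :
    HasTimeAvg (sharpSum ω f) (f 0) := by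
  unfold HasTimeAvg
  have h1 : ∀ T : ℝ, (1 / T) • ∫ σ in (0:ℝ)..T, sharpSum ω f σ =
      ∑' α, (((1 / T : ℝ) : ℂ) *
        ∫ σ in (0:ℝ)..T, Complex.exp (Complex.I * (dotIdx ω α : ℂ) * (σ : ℂ))) • f α := by
    intro T
    have := intervalIntegral.hasSum_integral_of_dominated_convergence (μ := volume)
      (a := 0) (b := T)
      (F := fun α σ => Complex.exp (Complex.I * (dotIdx ω α : ℂ) * (σ : ℂ)) • f α)
      (f := sharpSum ω f) (fun α _ => ‖f α‖)
      (fun α => Continuous.aestronglyMeasurable (by fun_prop))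
      (fun α => Eventually.of_forall fun σ _ => by rw [norm_smul, norm_phase, one_mul])
      (Eventually.of_forall fun _ _ => hf) intervalIntegrable_const
      (Eventually.of_forall fun σ _ => (summable_norm_term ω hf σ).of_norm.hasSum)
    rw [← (this.const_smul (1 / T)).tsum_eq]
    refine tsum_congr fun α => ?_
    rw [intervalIntegral.integral_smul_const, mul_smul]
    rfl
  simp_rw [h1]
  have h2 : f 0 = ∑' α, (if α = 0 then (1:ℂ) else 0) • f α := by
    rw [tsum_eq_single 0 fun α hα => by simp [hα]]
    simp
  rw [h2]
  refine tendsto_tsum_of_dominated_convergence hf (fun α => (phase_avg ω hres α).smul_const _) ?_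
  filter_upwards [eventually_gt_atTop 0] with T hT α
  rw [norm_smul]
  exact mul_le_of_le_one_left (norm_nonneg _) (phase_avg_norm hT)

lemma IsSharpFlat.hasTimeAvg {r : ℕ} {ω : Fin r → ℝ}
    (hres : ∀ α : Fin r → ℤ, dotIdx ω α = 0 → α = 0) {κ : ℝ} (hκ : 0 ≤ κ)
    {a : ℝ → (X →L[ℂ] X)} {ah : (Fin r → ℤ) → (X →L[ℂ] X)} {af : ℝ → (X →L[ℂ] X)}
    (ha : IsSharpFlat ω κ a ah af) : HasTimeAvg a (ah 0) := by
  have hca := summable_norm_of_wt hκ ha.summable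
  have h1 := sharp_avg ω hres hca
  have h2 : Tendsto (fun T : ℝ => (1 / T) • ∫ σ in (0:ℝ)..T, af σ) atTop (nhds 0) := by
    have hz : Tendsto (fun T : ℝ => (1 / T) * flatSup af) atTop (nhds 0) := by
      simpa using (tendsto_inv_atTop_zero (𝕜 := ℝ)).mul_const (flatSup af)
    refine squeeze_zero_norm' ?_ hz
    filter_upwards [eventually_gt_atTop 0] with T hT
    rw [norm_smul, Real.norm_of_nonneg (by positivity)]
    gcongr
    have hb : ∀ σ ∈ Set.Ioc 0 T, ‖af σ‖ ≤ flatSup af * Real.exp (-σ) := fun σ hσ => by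
      have := flat_le ha.flat_bdd hσ.1.le
      rw [Real.exp_neg, ← div_eq_mul_inv, le_div_iff₀ (Real.exp_pos _), mul_comm]
      exact this
    have hi : ∫ σ in (0:ℝ)..T, flatSup af * Real.exp (-σ) = flatSup af * (1 - Real.exp (-T)) := by
      rw [intervalIntegral.integral_const_mul]
      simp
    refine (intervalIntegral.norm_integral_le_of_norm_le hT.le
      (Eventually.of_forall hb) ?_).trans ?_
    · exact Continuous.intervalIntegrable (by fun_prop) _ _
    · rw [hi]
      refine mul_le_of_le_one_right (flatSup_nonneg' _) ?_
      have := Real.exp_pos (-T)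
      linarith
  have h3 := h1.add h2
  rw [add_zero] at h3
  refine h3.congr' ?_
  filter_upwards [eventually_gt_atTop 0] with T hT
  have hsub : Set.uIcc 0 T ⊆ Set.Ici 0 := by
    rw [Set.uIcc_of_le hT.le]; exact Set.Icc_subset_Ici_self
  rw [← smul_add, ← intervalIntegral.integral_add
    ((continuous_sharpSum ω hca).intervalIntegrable _ _)
    (ha.flat_cont.mono hsub).intervalIntegrable]
  congr 1
  exact intervalIntegral.integral_congr fun σ hσ => (ha.decomp σ (hsub hσ)).symm

lemma norm_phi_le {r : ℕ} {κ c : ℝ} {ω : Fin r → ℝ} {φ : ℝ → (X →L[ℂ] X)}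
    {φhat : (Fin r → ℤ) → (X →L[ℂ] X)} {φflat : ℝ → (X →L[ℂ] X)}
    (hφ : IsSharpFlat ω κ φ φhat φflat)
    (hφc : SFNorm κ (fun α => if α = 0 then φhat 0 - 1 else φhat α) φflat ≤ c) :
    SFNorm κ φhat φflat ≤ 1 + c := by
  have hw0 : Real.exp (κ * absIdx (0 : Fin r → ℤ)) = 1 := by simp [absIdx]
  have hone : ‖(1 : X →L[ℂ] X)‖ ≤ 1 := ContinuousLinearMap.norm_id_le
  have hd : HasSum (fun α : Fin r → ℤ => if α = 0 then (1:ℝ) else 0) 1 := hasSum_ite_eq 0 1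
  have hs : Summable fun α : Fin r → ℤ => Real.exp (κ * absIdx α) *
      ‖(if α = 0 then φhat 0 - 1 else φhat α)‖ := by
    refine Summable.of_nonneg_of_le (fun _ => by positivity) (fun α => ?_)
      (hφ.summable.add hd.summable)
    by_cases h : α = 0
    · subst h
      simp only [if_true, hw0, one_mul]
      exact (norm_sub_le _ _).trans (by gcongr)
    · simp [h]
  have h : sharpNorm κ φhat ≤
      sharpNorm κ (fun α => if α = 0 then φhat 0 - 1 else φhat α) + 1 := by
    unfold sharpNorm
    rw [← hd.tsum_eq, ← hs.tsum_add hd.summable]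
    refine hφ.summable.tsum_le_tsum (fun α => ?_) (hs.add hd.summable)
    by_cases h : α = 0
    · subst h
      simp only [if_true, hw0, one_mul]
      have := norm_add_le (φhat 0 - 1) 1
      rw [sub_add_cancel] at this
      linarith
    · simp [h]
  unfold SFNorm at *
  linarith

/-- bound on the operator `Λ`. If `a` is sharp-flat of class `κ` with
`𝒩_κ(a) ≤ M` and `φ` is sharp-flat of class `κ` with `𝒩_κ(φ − id) ≤ c`, `c ∈ (0,1)`,
then the time average `⟨aφ⟩` exists, `Λ{φ}_τ = a_τφ_τ − φ_τ⟨aφ⟩` is sharp-flat of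
class `κ`, and `𝒩_κ(Λ{φ}) ≤ (2+c)(1+c)M`. -/
theorem Lambda_bound
    {r : ℕ} (ω : Fin r → ℝ)
    (hres : ∀ α : Fin r → ℤ, dotIdx ω α = 0 → α = 0)
    {κ : ℝ} (hκ : 0 ≤ κ) (M c : ℝ) (hM : 0 < M) (hc0 : 0 < c) (hc1 : c < 1)
    (a : ℝ → (X →L[ℂ] X))
    (ahat : (Fin r → ℤ) → (X →L[ℂ] X)) (aflat : ℝ → (X →L[ℂ] X))
    (ha : IsSharpFlat ω κ a ahat aflat) (haM : SFNorm κ ahat aflat ≤ M)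
    (φ : ℝ → (X →L[ℂ] X))
    (φhat : (Fin r → ℤ) → (X →L[ℂ] X)) (φflat : ℝ → (X →L[ℂ] X))
    (hφ : IsSharpFlat ω κ φ φhat φflat)
    (hφc : SFNorm κ (fun α => if α = 0 then φhat 0 - 1 else φhat α) φflat ≤ c) :
    ∃ B : X →L[ℂ] X,
      HasTimeAvg (fun τ => a τ ∘L φ τ) B ∧
      ∃ (Λhat : (Fin r → ℤ) → (X →L[ℂ] X)) (Λflat : ℝ → (X →L[ℂ] X)),
        IsSharpFlat ω κ (fun τ => a τ ∘L φ τ - φ τ ∘L B) Λhat Λflat ∧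
        SFNorm κ Λhat Λflat ≤ (2 + c) * (1 + c) * M := by
  obtain ⟨h1, n1⟩ := ha.mul' hκ hφ
  have hφn := norm_phi_le hφ hφc
  have hP : SFNorm κ ahat aflat * SFNorm κ φhat φflat ≤ M * (1 + c) :=
    mul_le_mul haM hφn (add_nonneg (sharpNorm_nonneg' _ _) (flatSup_nonneg' _)) hM.le
  have n2 := n1.trans hP
  obtain ⟨h3, n3⟩ := hφ.mul_const' hκ (convHat ahat φhat 0)
  obtain ⟨h4, n4⟩ := h1.sub' hκ h3
  have hB : ‖convHat ahat φhat 0‖ ≤ M * (1 + c) := by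
    refine le_trans ?_ n2
    refine (norm_le_wt hκ _ 0).trans ?_
    refine (h1.summable.le_tsum 0 fun _ _ => by positivity).trans ?_
    exact le_add_of_nonneg_right (flatSup_nonneg' _)
  refine ⟨convHat ahat φhat 0, h1.hasTimeAvg hres hκ, _, _, h4, n4.trans ?_⟩
  have n5 : SFNorm κ φhat φflat * ‖convHat ahat φhat 0‖ ≤ (1 + c) * (M * (1 + c)) :=
    mul_le_mul hφn hB (norm_nonneg _) (by linarith)
  linarith
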